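/- arXiv:2002.09898 — 2 statements merged into one kernel-verified Lean document; each statement's English description precedes it below -/
import Mathlib

section
/- Let n ≥ 1 and work in ℝ^n (EuclideanSpace ℝ (Fin n)). Let A be a symmetric positive definite n×n real matrix, b ∈ ℝ^n, and x* ∈ ℝ^n with A x* = b. Let (x^i)_{i ≥ 0}, (p_i)_{i ≥ 0} and scalars (α_i)_{i ≥ 1} satisfy x^0 = 0 and x^{i+1} = x^i + α_{i+1}•p_i for all i, and assume the conjugate-gradient orthogonality relations ⟪p_j, A x^i − b⟫ = 0 for all j < i. Let λ > 0 satisfy ⟪Av, v⟫ ≥ λ·‖v‖² for all v. Then for every i: (a) ⟪x* − x^i, A(x* − x^i)⟫ = ⟪x* − x^{i+1}, A(x* − x^{i+1})⟫ + α_{i+1}²·⟪p_i, A p_i⟫, so the A-norm errors ‖x* − x^i‖_A are nonincreasing; (b) ⟪x^i, b⟫ = ⟪x*, A x*⟫ − ⟪x* − x^i, A(x* − x^i)⟫, so ⟪x^i, b⟫ is nondecreasing in i; and (c) ⟪x^i, b⟫ ≤ ⟪b, A⁻¹ b⟫ ≤ ‖b‖²/λ. -/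
open RealInnerProductSpace

section InnerProductSpace

variable {E : Type*} [NormedAddCommGroup E] [InnerProductSpace ℝ E]

/-- Iterates started at `0` stay orthogonal to every vector orthogonal to the directions used. -/
theorem inner_iterate_eq_zero {x p : ℕ → E} {α : ℕ → ℝ} (hx0 : x 0 = 0)
    (hupd : ∀ i, x (i + 1) = x i + α (i + 1) • p i) {w : E} {i : ℕ}
    (hw : ∀ j < i, ⟪p j, w⟫ = 0) : ⟪x i, w⟫ = 0 := by
  induction i with
  | zero => simp [hx0]
  | succ k ih =>
    rw [hupd, inner_add_left, real_inner_smul_left, hw k k.lt_succ_self,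
      ih fun j hj => hw j (hj.trans k.lt_succ_self), mul_zero, add_zero]

/-- Pythagoras for the form `⟪u, A v⟫` of a symmetric operator `A`. -/
theorem LinearMap.IsSymmetric.inner_add_smul_of_inner_eq_zero {A : E →ₗ[ℝ] E}
    (hA : A.IsSymmetric) {e p : E} (h : ⟪p, A e⟫ = 0) (c : ℝ) :
    ⟪e + c • p, A (e + c • p)⟫ = ⟪e, A e⟫ + c ^ 2 * ⟪p, A p⟫ := by
  have h' : ⟪e, A p⟫ = 0 := by rw [← hA, real_inner_comm, h]
  simp only [map_add, map_smul, inner_add_left, inner_add_right, real_inner_smul_left,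
    real_inner_smul_right, h, h']
  ring

/-- If `A y = b` and `x` is orthogonal to the residual `A x - b`, then `⟪x, b⟫` is the energy of
`y` minus the energy of the error `y - x`. -/
theorem LinearMap.IsSymmetric.inner_eq_sub_of_inner_residual_eq_zero {A : E →ₗ[ℝ] E}
    (hA : A.IsSymmetric) {x y b : E} (hy : A y = b) (h : ⟪x, A x - b⟫ = 0) :
    ⟪x, b⟫ = ⟪y, A y⟫ - ⟪y - x, A (y - x)⟫ := by
  have h' : ⟪y, A x⟫ = ⟪x, b⟫ := by rw [← hA, hy, real_inner_comm]
  rw [inner_sub_right] at h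
  simp only [map_sub, inner_sub_left, inner_sub_right, h', hy]
  linarith

theorem inner_le_norm_sq_div {b y : E} {c : ℝ} (hc : 0 < c) (h : c * ‖y‖ ^ 2 ≤ ⟪b, y⟫) :
    ⟪b, y⟫ ≤ ‖b‖ ^ 2 / c := by
  have hsq := norm_sub_sq_real b (c • y)
  rw [real_inner_smul_right, norm_smul, mul_pow, Real.norm_eq_abs, sq_abs] at hsq
  rw [le_div_iff₀ hc]
  nlinarith [sq_nonneg ‖b - c • y‖, mul_le_mul_of_nonneg_left h hc.le]

end InnerProductSpace

/-- Monotonicity properties of conjugate gradient iterates for `Ax = b`, `x⁰ = 0`: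
(a) the `A`-norm errors decrease with the stated recursion,
(b) `⟪xⁱ, b⟫ = ⟪x*, Ax*⟫ − ‖x* − xⁱ‖²_A` is nondecreasing,
(c) `⟪xⁱ, b⟫ ≤ ⟪b, A⁻¹b⟫ ≤ ‖b‖²/λ`. -/
theorem cg_inner_product_bounds
    (n : ℕ) (hn : 1 ≤ n)
    (A : EuclideanSpace ℝ (Fin n) →ₗ[ℝ] EuclideanSpace ℝ (Fin n))
    (hAsymm : ∀ u v : EuclideanSpace ℝ (Fin n), ⟪A u, v⟫ = ⟪u, A v⟫)
    (lam : ℝ) (hlam : 0 < lam)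
    (hpd : ∀ v : EuclideanSpace ℝ (Fin n), lam * ‖v‖ ^ 2 ≤ ⟪A v, v⟫)
    (b xstar : EuclideanSpace ℝ (Fin n)) (hxstar : A xstar = b)
    (x p : ℕ → EuclideanSpace ℝ (Fin n)) (α : ℕ → ℝ)
    (hx0 : x 0 = 0)
    (hupd : ∀ i : ℕ, x (i + 1) = x i + α (i + 1) • p i)
    (horth : ∀ i j : ℕ, j < i → ⟪p j, A (x i) - b⟫ = 0) :
    (∀ i : ℕ,
      ⟪xstar - x i, A (xstar - x i)⟫ =
        ⟪xstar - x (i + 1), A (xstar - x (i + 1))⟫ + α (i + 1) ^ 2 * ⟪p i, A (p i)⟫ ∧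
      ⟪xstar - x (i + 1), A (xstar - x (i + 1))⟫ ≤ ⟪xstar - x i, A (xstar - x i)⟫) ∧
    (∀ i : ℕ,
      ⟪x i, b⟫ = ⟪xstar, A xstar⟫ - ⟪xstar - x i, A (xstar - x i)⟫ ∧
      ⟪x i, b⟫ ≤ ⟪x (i + 1), b⟫) ∧
    (∀ i : ℕ, ⟪x i, b⟫ ≤ ⟪b, xstar⟫ ∧ ⟪b, xstar⟫ ≤ ‖b‖ ^ 2 / lam) := by
  have hA : A.IsSymmetric := hAsymm
  have hnonneg : ∀ v, 0 ≤ ⟪v, A v⟫ := fun v =>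
    hAsymm v v ▸ (mul_nonneg hlam.le (sq_nonneg _)).trans (hpd v)
  have herr : ∀ i, ⟪xstar - x i, A (xstar - x i)⟫ =
      ⟪xstar - x (i + 1), A (xstar - x (i + 1))⟫ + α (i + 1) ^ 2 * ⟪p i, A (p i)⟫ := fun i => by
    have horth' : ⟪p i, A (xstar - x (i + 1))⟫ = 0 := by
      rw [map_sub, hxstar, ← neg_sub, inner_neg_right, horth _ _ i.lt_succ_self, neg_zero]
    have hsplit : xstar - x i = xstar - x (i + 1) + α (i + 1) • p i := by
      rw [hupd]
      abel
    rw [hsplit, hA.inner_add_smul_of_inner_eq_zero horth']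
  have hanti : ∀ i, ⟪xstar - x (i + 1), A (xstar - x (i + 1))⟫ ≤
      ⟪xstar - x i, A (xstar - x i)⟫ := fun i => by
    rw [herr i]
    exact le_add_of_nonneg_right (mul_nonneg (sq_nonneg _) (hnonneg _))
  have hinner : ∀ i, ⟪x i, b⟫ = ⟪xstar, A xstar⟫ - ⟪xstar - x i, A (xstar - x i)⟫ := fun i =>
    hA.inner_eq_sub_of_inner_residual_eq_zero hxstar
      (inner_iterate_eq_zero hx0 hupd fun j hj => horth i j hj)
  refine ⟨fun i => ⟨herr i, hanti i⟩, fun i => ⟨hinner i, ?_⟩, fun i => ⟨?_, ?_⟩⟩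
  · rw [hinner i, hinner (i + 1)]
    exact sub_le_sub_left (hanti i) _
  · rw [hinner i, hxstar, real_inner_comm]
    exact sub_le_self _ (hnonneg _)
  · exact inner_le_norm_sq_div hlam (hxstar ▸ hpd xstar)
end

section
/- Let n ≥ 1 and work in ℝ^n (EuclideanSpace ℝ (Fin n)). Let M be a symmetric positive definite n×n real matrix and b ∈ ℝ^n. Let (r_i)_{i ≥ 0} and (p_i)_{i ≥ 0} be sequences with r_0 = −b and p_0 = M⁻¹ b, and suppose r_j ≠ 0 for all j ≤ m and that for 1 ≤ i ≤ m: p_i = −M⁻¹ r_i + β_i • p_{i−1} with β_i = ⟪r_i, M⁻¹ r_i⟫ / ⟪r_{i−1}, M⁻¹ r_{i−1}⟫, and the M⁻¹-orthogonality ⟪r_i, M⁻¹ r_j⟫ = 0 holds for all i ≠ j with i, j ≤ m. Then for every i ≤ m: ⟪p_i, b⟫ = ⟪r_i, M⁻¹ r_i⟫. -/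
open RealInnerProductSpace

/-- Property II of the preconditioned conjugate gradient method: with preconditioner `M`
(symmetric positive definite, inverse `Minv`), residuals `r₀ = −b`, directions
`p₀ = M⁻¹b`, `pᵢ = −M⁻¹rᵢ + βᵢ•pᵢ₋₁`, and pairwise `M⁻¹`-orthogonal residuals,
one has `⟪pᵢ, b⟫ = ⟪rᵢ, M⁻¹rᵢ⟫` for all `i ≤ m`. -/
theorem pcg_direction_inner_product
    (n : ℕ) (hn : 1 ≤ n)
    (M Minv : EuclideanSpace ℝ (Fin n) →ₗ[ℝ] EuclideanSpace ℝ (Fin n))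
    (hMsymm : ∀ u v : EuclideanSpace ℝ (Fin n), ⟪M u, v⟫ = ⟪u, M v⟫)
    (hMpd : ∀ v : EuclideanSpace ℝ (Fin n), v ≠ 0 → 0 < ⟪M v, v⟫)
    (hMinv : ∀ v : EuclideanSpace ℝ (Fin n), M (Minv v) = v)
    (hMinv' : ∀ v : EuclideanSpace ℝ (Fin n), Minv (M v) = v)
    (b : EuclideanSpace ℝ (Fin n))
    (m : ℕ)
    (r p : ℕ → EuclideanSpace ℝ (Fin n))
    (hr0 : r 0 = -b) (hp0 : p 0 = Minv b)
    (hrne : ∀ j : ℕ, j ≤ m → r j ≠ 0)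
    (hp : ∀ i : ℕ, 1 ≤ i → i ≤ m →
      p i = -(Minv (r i)) +
        (⟪r i, Minv (r i)⟫ / ⟪r (i - 1), Minv (r (i - 1))⟫) • p (i - 1))
    (horth : ∀ i j : ℕ, i ≤ m → j ≤ m → i ≠ j → ⟪r i, Minv (r j)⟫ = 0) :
    ∀ i : ℕ, i ≤ m → ⟪p i, b⟫ = ⟪r i, Minv (r i)⟫ := by
  intro i
  induction i with
  | zero =>
    intro _
    simp [hr0, hp0, real_inner_comm]
  | succ k ih =>
    intro hk
    have hkm : k ≤ m := by omega
    have hMinv_ne : Minv (r k) ≠ 0 := fun h => hrne k hkm (by rw [← hMinv (r k), h, map_zero])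
    have hpos : 0 < ⟪r k, Minv (r k)⟫ := by
      simpa only [hMinv] using hMpd _ hMinv_ne
    have hb : ⟪Minv (r (k + 1)), b⟫ = 0 := by
      have h := horth 0 (k + 1) (Nat.zero_le m) hk (by omega)
      rwa [hr0, inner_neg_left, neg_eq_zero, real_inner_comm] at h
    rw [hp (k + 1) (by omega) hk, Nat.add_sub_cancel, inner_add_left, inner_neg_left, hb,
      real_inner_smul_left, ih hkm, div_mul_cancel₀ _ hpos.ne', neg_zero, zero_add]
end
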